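/- Assume 0 ∉ S(G). Then for every g ∈ G and a_0 ∈ A_0: a_0·u_g ∈ T if and only if a_0 ∈ J. Consequently T = ⊕_{g∈G} J·u_g, i.e. an element a = Σ_g a_g·u_g of A (with homogeneous components a_g ∈ A_0) lies in T if and only if every a_g lies in J. -/

import Mathlib

/-- Finitely many elements, each killed on the left by some member of a submonoid all of whose
elements `s` satisfy `s * R ⊆ R * s`, have a common left annihilator in that submonoid. -/
theorem exists_common_left_annihilator {R ι : Type*} [Ring R] (S : Submonoid R)
    (hS : ∀ s ∈ S, ∀ a : R, ∃ b : R, s * a = b * s) (c : ι → R) (F : Finset ι)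
    (hF : ∀ i ∈ F, ∃ s ∈ S, s * c i = 0) : ∃ s ∈ S, ∀ i ∈ F, s * c i = 0 := by
  classical
  induction F using Finset.induction_on with
  | empty => exact ⟨1, S.one_mem, by simp⟩
  | insert j F _ ih =>
    obtain ⟨s, hs, hsF⟩ := ih fun i hi => hF i (Finset.mem_insert_of_mem hi)
    obtain ⟨t, ht, htj⟩ := hF j (Finset.mem_insert_self j F)
    refine ⟨s * t, S.mul_mem hs ht, fun i hi => ?_⟩
    rcases Finset.mem_insert.mp hi with rfl | hi
    · rw [mul_assoc, htj, mul_zero]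
    · obtain ⟨b, hb⟩ := hS s hs t
      rw [hb, mul_assoc, hsF i hi, mul_zero]

/-- The property `s * R ⊆ R * s` passes from generators to the submonoid they generate. -/
theorem exists_mul_eq_mul_of_mem_closure {R : Type*} [Monoid R] {X : Set R}
    (hX : ∀ x ∈ X, ∀ a : R, ∃ b : R, x * a = b * x) :
    ∀ s ∈ Submonoid.closure X, ∀ a : R, ∃ b : R, s * a = b * s := by
  intro s hs
  induction hs using Submonoid.closure_induction with
  | mem x hx => exact hX x hx
  | one => exact fun a => ⟨a, by simp⟩
  | mul x y _ _ hx hy =>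
    intro a
    obtain ⟨b, hb⟩ := hy a
    obtain ⟨d, hd⟩ := hx b
    exact ⟨d, by rw [mul_assoc, hb, ← mul_assoc, hd, mul_assoc]⟩


theorem stmt_14 {A : Type*} [Ring A] {G : Type*} [Group G]
    (A₀ : Subring A) (u : G → A)
    (hu1 : u 1 = 1) (hune : ∀ g : G, u g ≠ 0)
    (C1span : ∀ a : A, ∃ c : G →₀ A₀, a = c.sum fun g x => (x : A) * u g)
    (C1ind : ∀ c : G →₀ A₀, (c.sum fun g x => (x : A) * u g) = 0 → c = 0)
    (C2set : ∀ g : G, {x : A | ∃ a₀ : A₀, x = (a₀ : A) * u g} =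
        {x : A | ∃ a₀ : A₀, x = u g * (a₀ : A)})
    (C2free : ∀ (g : G) (a₀ : A₀), (a₀ : A) * u g = 0 → a₀ = 0)
    (C3 : ∀ (g h : G) (a₀ b₀ : A₀), ∃ c₀ : A₀,
        ((a₀ : A) * u g) * ((b₀ : A) * u h) = (c₀ : A) * u (g * h))
    (σ : G → A₀ → A₀)
    (hσ : ∀ (g : G) (a₀ : A₀), u g * (a₀ : A) = ((σ g a₀ : A₀) : A) * u g)
    (α : G → G → A₀)
    (hα : ∀ g h : G, u g * u h = ((α g h : A₀) : A) * u (g * h))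
    (h0 : (0 : A₀) ∉ (Submonoid.closure {x : A₀ | ∃ g : G, x = α g g⁻¹} : Submonoid A₀)) :
    (∀ (g : G) (a₀ : A₀),
      ((∃ s ∈ (Submonoid.closure {x : A₀ | ∃ g : G, x = α g g⁻¹} : Submonoid A₀), ((s : A₀) : A) * ((a₀ : A) * u g) = 0) ↔
        ∃ s ∈ (Submonoid.closure {x : A₀ | ∃ g : G, x = α g g⁻¹} : Submonoid A₀), s * a₀ = 0)) ∧
    (∀ c : G →₀ A₀,
      ((∃ s ∈ (Submonoid.closure {x : A₀ | ∃ g : G, x = α g g⁻¹} : Submonoid A₀),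
          ((s : A₀) : A) * (c.sum fun g x => (x : A) * u g) = 0) ↔
        ∀ g : G, ∃ s ∈ (Submonoid.closure {x : A₀ | ∃ g : G, x = α g g⁻¹} : Submonoid A₀), s * c g = 0)) := by
  have hgen : ∀ x ∈ {x : A₀ | ∃ g : G, x = α g g⁻¹}, ∀ a : A₀, ∃ b : A₀, x * a = b * x := by
    rintro x ⟨g, rfl⟩ a
    have hα' : ((α g g⁻¹ : A₀) : A) = u g * u g⁻¹ := by rw [hα, mul_inv_cancel, hu1, mul_one]
    refine ⟨σ g (σ g⁻¹ a), Subtype.ext ?_⟩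
    push_cast
    rw [hα', mul_assoc, hσ, ← mul_assoc, hσ, mul_assoc]
  have hnormal := exists_mul_eq_mul_of_mem_closure hgen
  refine ⟨fun g a₀ => ⟨?_, ?_⟩, fun c => ?_⟩
  · rintro ⟨s, hs, h⟩
    exact ⟨s, hs, C2free g _ (by rw [Subring.coe_mul, mul_assoc, h])⟩
  · rintro ⟨s, hs, h⟩
    exact ⟨s, hs, by rw [← mul_assoc, ← Subring.coe_mul, h, Subring.coe_zero, zero_mul]⟩
  · have hsum (s : A₀) : (s : A) * (c.sum fun g x => (x : A) * u g) =
        (c.mapRange (s * ·) (mul_zero s)).sum fun g x => (x : A) * u g := by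
      rw [Finsupp.sum_mapRange_index (by simp), Finsupp.mul_sum]
      simp [mul_assoc]
    constructor
    · rintro ⟨s, hs, h⟩ g
      refine ⟨s, hs, ?_⟩
      simpa using DFunLike.congr_fun (C1ind _ ((hsum s).symm.trans h)) g
    · intro h
      obtain ⟨s, hs, hsc⟩ := exists_common_left_annihilator _ hnormal c c.support fun g _ => h g
      refine ⟨s, hs, ?_⟩
      rw [Finsupp.mul_sum]
      refine Finset.sum_eq_zero fun g hg => ?_
      beta_reduce
      rw [← mul_assoc, ← Subring.coe_mul, hsc g hg, Subring.coe_zero, zero_mul]
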